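/- arXiv:2604.03965 — 6 statements merged into one kernel-verified Lean document; each statement's English description precedes it below -/
import Mathlib

section
/- Let A be a d×d complex matrix whose characteristic polynomial splits as ∏_{i=1}^d (X − λ_i) for complex numbers λ_1, …, λ_d (the eigenvalues counted with algebraic multiplicity), and let c ∈ ℂ. Fix n ≥ 0 and let Φ be the ℂ-linear endomorphism of the space of homogeneous polynomials of degree n in d variables over ℂ defined by (Φ P)(x) = c · P(A x) (i.e. Φ substitutes the linear forms given by the rows of A into P and multiplies by c). Then for every tuple of nonnegative integers (n_1, …, n_d) with n_1 + ⋯ + n_d = n, the complex number c · λ_1^{n_1} ⋯ λ_d^{n_d} is an eigenvalue of Φ. -/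
open MvPolynomial in
/-- A root of the characteristic polynomial of `A` is the eigenvalue of a nonzero linear form under
the substitution of the rows of `A`. -/
theorem exists_linear_form_substitution_eq_smul {K σ : Type*} [Field K] [Fintype σ] [DecidableEq σ]
    (A : Matrix σ σ K) (a : K) (ha : A.charpoly.IsRoot a) :
    ∃ L : MvPolynomial σ K, L.IsHomogeneous 1 ∧ L ≠ 0 ∧
      aeval (fun i => ∑ j, C (A i j) * X j) L = C a * L := by
  rw [Polynomial.IsRoot.def, Matrix.eval_charpoly] at ha
  obtain ⟨v, hv, hvA⟩ := Matrix.exists_vecMul_eq_zero_iff.mpr ha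
  have hvA' (j : σ) : ∑ i, v i * A i j = a * v j := by
    have h := congrFun hvA j
    rw [Matrix.vecMul_sub, Matrix.scalar_apply, Pi.sub_apply, Matrix.vecMul_diagonal,
      Pi.zero_apply, sub_eq_zero, mul_comm] at h
    exact h.symm
  refine ⟨∑ i, C (v i) * X i, IsHomogeneous.sum _ _ _ fun i _ => ?_, fun h => hv ?_, ?_⟩
  · simpa using (isHomogeneous_C σ (v i)).mul (isHomogeneous_X K i)
  · ext i
    have h' := congrArg (aeval (Pi.single i (1 : K))) h
    simpa [Pi.single_apply] using h'
  · simp only [map_sum, map_mul, aeval_X, algHom_C, algebraMap_eq, Finset.mul_sum]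
    rw [Finset.sum_comm]
    refine Finset.sum_congr rfl fun j _ => ?_
    simp only [← mul_assoc, ← Finset.sum_mul, ← C_mul, ← map_sum, hvA']


/-- if the characteristic polynomial of `A` splits with roots
`λ_1, …, λ_d`, then for each multi-index `(n_1, …, n_d)` with `∑ n_i = n`, the number
`c · λ_1^{n_1} ⋯ λ_d^{n_d}` is an eigenvalue of the endomorphism
`P ↦ c • P(A x)` of the space of homogeneous polynomials of degree `n`. -/
theorem graded_substitution_eigenvalue
    {d : ℕ} (A : Matrix (Fin d) (Fin d) ℂ) (lam : Fin d → ℂ)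
    (hA : A.charpoly = ∏ i : Fin d, (Polynomial.X - Polynomial.C (lam i)))
    (c : ℂ) (n : ℕ) (nn : Fin d → ℕ) (hnn : ∑ i, nn i = n) :
    ∃ P : MvPolynomial (Fin d) ℂ,
      P ∈ MvPolynomial.homogeneousSubmodule (Fin d) ℂ n ∧ P ≠ 0 ∧
      c • (MvPolynomial.aeval
          (fun i => ∑ j, MvPolynomial.C (A i j) * MvPolynomial.X j) P) =
        (c * ∏ i, lam i ^ nn i) • P := by
  have hroot (i : Fin d) : A.charpoly.IsRoot (lam i) := by
    rw [hA, Polynomial.IsRoot.def, Polynomial.eval_prod]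
    exact Finset.prod_eq_zero (Finset.mem_univ i) (by simp)
  choose L hhom hne hL using
    fun i => exists_linear_form_substitution_eq_smul A (lam i) (hroot i)
  refine ⟨∏ i, L i ^ nn i, ?_, Finset.prod_ne_zero_iff.mpr fun i _ => pow_ne_zero _ (hne i), ?_⟩
  · rw [MvPolynomial.mem_homogeneousSubmodule, ← hnn]
    exact MvPolynomial.IsHomogeneous.prod _ _ _ fun i _ => by simpa using (hhom i).pow (nn i)
  · simp only [map_prod, map_pow, hL, mul_pow, Finset.prod_mul_distrib,
      MvPolynomial.smul_eq_C_mul, map_mul, mul_assoc]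
end

section
/- Let W be a finite-dimensional complex normed vector space and A : W → W a ℂ-linear map. (i) If A is hypercyclic, i.e. there exists x ∈ W such that the orbit {A^n x : n ≥ 0} is dense in W, then W = {0}. (ii) If A is supercyclic, i.e. there exists x ∈ W such that {c • A^n x : c ∈ ℂ, n ≥ 0} is dense in W, then dim_ℂ W ≤ 1. -/
open Module

section DualEigenvectors

variable {V : Type*} [AddCommGroup V] [Module ℂ V]

/-- A functional which is an eigenvector of the transpose of `A` is multiplied by the `n`-th power
of the eigenvalue along `A ^ n`. -/
theorem apply_pow_of_dual_eigenvector {A : V →ₗ[ℂ] V} {φ : Dual ℂ V} {l : ℂ}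
    (hφ : ∀ v, φ (A v) = l * φ v) (n : ℕ) (v : V) : φ ((A ^ n) v) = l ^ n * φ v := by
  induction n with
  | zero => simp
  | succ n ih => rw [pow_succ', Module.End.mul_apply, hφ, ih]; ring

/-- Growth of a generalized eigenvector of rank two of the transpose of `A` along `A ^ n`. -/
theorem mul_apply_pow_of_dual_jordan_pair {A : V →ₗ[ℂ] V} {φ ψ : Dual ℂ V} {l : ℂ}
    (hφ : ∀ v, φ (A v) = l * φ v) (hψ : ∀ v, ψ (A v) = l * ψ v + φ v) (n : ℕ) (v : V) :
    l * ψ ((A ^ n) v) = l ^ n * (l * ψ v + n * φ v) := by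
  induction n with
  | zero => simp
  | succ n ih =>
    rw [pow_succ', Module.End.mul_apply, hψ, mul_add, ih, apply_pow_of_dual_eigenvector hφ]
    push_cast
    ring

/-- The transpose of an endomorphism of a nonzero finite-dimensional space has an eigenvector. -/
theorem exists_dual_eigenvector [FiniteDimensional ℂ V] [Nontrivial V] (A : V →ₗ[ℂ] V) :
    ∃ (φ : Dual ℂ V) (l : ℂ), φ ≠ 0 ∧ ∀ v, φ (A v) = l * φ v := by
  obtain ⟨l, hl⟩ := Module.End.exists_eigenvalue (K := ℂ) (V := Dual ℂ V) A.dualMap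
  obtain ⟨φ, hφ⟩ := hl.exists_hasEigenvector
  refine ⟨φ, l, hφ.2, fun v => ?_⟩
  simpa using LinearMap.congr_fun hφ.apply_eq_smul v

/-- Two functionals, the first nonzero and the second not a multiple of the first, take arbitrary
prescribed values at some vector. -/
theorem exists_apply_eq_of_notMem_span {φ ψ : Dual ℂ V} (hφ : φ ≠ 0)
    (hψ : ψ ∉ Submodule.span ℂ {φ}) (z w : ℂ) : ∃ v, φ v = z ∧ ψ v = w := by
  obtain ⟨u, hu⟩ : ∃ u, φ u ≠ 0 := by
    by_contra! h
    exact hφ (LinearMap.ext h)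
  obtain ⟨v, hv, hv'⟩ : ∃ v, φ v = 0 ∧ ψ v ≠ 0 := by
    by_contra! h
    refine hψ (Submodule.mem_span_singleton.2 ⟨ψ u / φ u, LinearMap.ext fun v => ?_⟩)
    have := h (v - (φ v / φ u) • u) (by simp [hu])
    simp only [map_sub, map_smul, smul_eq_mul, sub_eq_zero] at this
    rw [this, LinearMap.smul_apply, smul_eq_mul]
    ring
  refine ⟨(z / φ u) • u + ((w - z / φ u * ψ u) / ψ v) • v, ?_, ?_⟩
  · simp [hv, hu]
  · simp [hv']

/-- In dimension at least two, the transpose of an endomorphism has either two independent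
eigenvectors or a Jordan chain of length two. -/
theorem exists_dual_eigenpair_or_jordan_pair [FiniteDimensional ℂ V] (hV : 1 < finrank ℂ V)
    (A : V →ₗ[ℂ] V) :
    ∃ φ ψ : Dual ℂ V, (∀ z w, ∃ v, φ v = z ∧ ψ v = w) ∧ ∃ l : ℂ, (∀ v, φ (A v) = l * φ v) ∧
      ((∃ m : ℂ, ∀ v, ψ (A v) = m * ψ v) ∨ ∀ v, ψ (A v) = l * ψ v + φ v) := by
  have : Nontrivial V := Module.nontrivial_of_finrank_pos (R := ℂ) (by omega)
  obtain ⟨φ, l, hφ0, hφ⟩ := exists_dual_eigenvector A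
  set S := Submodule.span ℂ {φ} with hS
  have hSA : S ≤ S.comap A.dualMap := by
    rw [hS, Submodule.span_le, Set.singleton_subset_iff]
    exact Submodule.mem_span_singleton.2 ⟨l, LinearMap.ext fun v => by simp [hφ]⟩
  have hfr : finrank ℂ S = 1 := finrank_span_singleton hφ0
  have : Nontrivial (Dual ℂ V ⧸ S) := by
    rw [Submodule.Quotient.nontrivial_iff]
    intro h
    rw [h, finrank_top, Subspace.dual_finrank_eq] at hfr
    omega
  obtain ⟨m, hm⟩ := Module.End.exists_eigenvalue (K := ℂ) (S.mapQ S A.dualMap hSA)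
  obtain ⟨q, hq⟩ := hm.exists_hasEigenvector
  obtain ⟨ψ, rfl⟩ := S.mkQ_surjective q
  have hψS : ψ ∉ S := fun h => hq.2 ((Submodule.Quotient.mk_eq_zero S).2 h)
  obtain ⟨t, ht⟩ : ∃ t : ℂ, t • φ = A.dualMap ψ - m • ψ := by
    rw [← Submodule.mem_span_singleton, ← hS, ← Submodule.Quotient.eq]
    exact hq.apply_eq_smul
  have hψ : ∀ v, ψ (A v) = m * ψ v + t * φ v := fun v => by
    have := LinearMap.congr_fun ht v
    simp only [LinearMap.smul_apply, LinearMap.sub_apply, LinearMap.dualMap_apply,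
      smul_eq_mul] at this
    linear_combination -this
  have hsurj := exists_apply_eq_of_notMem_span hφ0 hψS
  by_cases hml : m = l
  · subst hml
    by_cases ht0 : t = 0
    · exact ⟨φ, ψ, hsurj, m, hφ, Or.inl ⟨m, by simpa [ht0] using hψ⟩⟩
    · refine ⟨t • φ, ψ, fun z w => ?_, m, fun v => ?_, Or.inr hψ⟩
      · obtain ⟨v, h1, h2⟩ := hsurj (z / t) w
        exact ⟨v, by simp [h1, mul_div_cancel₀, ht0], h2⟩
      · simp only [LinearMap.smul_apply, smul_eq_mul, hφ]
        ring
  · have hml' : m - l ≠ 0 := sub_ne_zero.2 hml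
    refine ⟨φ, ψ + (t / (m - l)) • φ, fun z w => ?_, l, hφ, Or.inl ⟨m, fun v => ?_⟩⟩
    · obtain ⟨v, h1, h2⟩ := hsurj z (w - t / (m - l) * z)
      exact ⟨v, h1, by simp [h1, h2]⟩
    · simp only [LinearMap.add_apply, LinearMap.smul_apply, smul_eq_mul, hφ, hψ]
      field_simp
      ring

end DualEigenvectors

section Orbits

variable {W : Type*} [NormedAddCommGroup W] [NormedSpace ℂ W] [FiniteDimensional ℂ W]
  {A : W →ₗ[ℂ] W} {x : W}

/-- If the transpose of `A` has a nonzero eigenvector, then `A` has no dense orbit. -/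
theorem not_dense_orbit_of_dual_eigenvector {φ : Dual ℂ W} {l : ℂ} (hφ0 : φ ≠ 0)
    (hφ : ∀ v, φ (A v) = l * φ v) : ¬ Dense {y : W | ∃ n : ℕ, y = (A ^ n) x} := by
  intro hd
  have hc : Continuous φ := φ.continuous_of_finiteDimensional
  have hsurj : Function.Surjective φ := LinearMap.surjective hφ0
  have key : ∀ p : ℂ → Prop, IsClosed {z | p z} → (∀ n : ℕ, p (l ^ n * φ x)) → ∀ z, p z := by
    intro p hp h z
    obtain ⟨v, rfl⟩ := hsurj z
    refine hd.induction (P := fun v => p (φ v)) ?_ (hp.preimage hc) v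
    rintro _ ⟨n, rfl⟩
    rw [apply_pow_of_dual_eigenvector hφ]
    exact h n
  rcases le_total ‖l‖ 1 with hl | hl
  · have := key (fun z => ‖z‖ ≤ ‖φ x‖) (isClosed_le continuous_norm continuous_const)
      (fun n => by
        rw [norm_mul, norm_pow]
        exact mul_le_of_le_one_left (norm_nonneg _) (pow_le_one₀ (norm_nonneg _) hl))
      ((‖φ x‖ + 1 : ℝ) : ℂ)
    rw [Complex.norm_real, Real.norm_of_nonneg (by positivity)] at this
    linarith
  · have h0 : φ x = 0 := by
      simpa using key (fun z => ‖φ x‖ ≤ ‖z‖) (isClosed_le continuous_const continuous_norm)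
        (fun n => by
          rw [norm_mul, norm_pow]
          exact le_mul_of_one_le_left (norm_nonneg _) (one_le_pow₀ hl)) 0
    exact one_ne_zero (key (fun z => z = 0) (isClosed_eq continuous_id continuous_const)
      (fun n => by simp [h0]) 1)

/-- A closed condition on the values of two jointly surjective functionals that holds along a dense
projective orbit holds everywhere. -/
theorem forall_of_dense_projective_orbit {φ ψ : Dual ℂ W}
    (hsurj : ∀ z w, ∃ v, φ v = z ∧ ψ v = w)
    (hd : Dense {y : W | ∃ (c : ℂ) (n : ℕ), y = c • (A ^ n) x}) (p : ℂ × ℂ → Prop)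
    (hp : IsClosed {q | p q})
    (h : ∀ (c : ℂ) (n : ℕ), p (c * φ ((A ^ n) x), c * ψ ((A ^ n) x))) (z w : ℂ) : p (z, w) := by
  obtain ⟨v, rfl, rfl⟩ := hsurj z w
  refine hd.induction (P := fun v => p (φ v, ψ v)) ?_ (hp.preimage
    (φ.continuous_of_finiteDimensional.prodMk ψ.continuous_of_finiteDimensional)) v
  rintro _ ⟨c, n, rfl⟩
  simpa using h c n

/-- A vector with dense projective orbit is not annihilated by a dual eigenvector that is part of a
jointly surjective pair. -/
theorem apply_ne_zero_of_dense_projective_orbit {φ ψ : Dual ℂ W} {l : ℂ}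
    (hsurj : ∀ z w, ∃ v, φ v = z ∧ ψ v = w) (hφ : ∀ v, φ (A v) = l * φ v)
    (hd : Dense {y : W | ∃ (c : ℂ) (n : ℕ), y = c • (A ^ n) x}) : φ x ≠ 0 := fun h0 =>
  one_ne_zero (forall_of_dense_projective_orbit hsurj hd (fun q => q.1 = 0)
    (isClosed_eq continuous_fst continuous_const)
    (fun c n => by simp [apply_pow_of_dual_eigenvector hφ, h0]) 1 0)

/-- If the transpose of `A` has two independent eigenvectors, then `A` has no dense projective
orbit. -/
theorem not_dense_projective_orbit_of_norm_le {φ ψ : Dual ℂ W} {l m : ℂ}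
    (hsurj : ∀ z w, ∃ v, φ v = z ∧ ψ v = w) (hφ : ∀ v, φ (A v) = l * φ v)
    (hψ : ∀ v, ψ (A v) = m * ψ v) (hlm : ‖l‖ ≤ ‖m‖) :
    ¬ Dense {y : W | ∃ (c : ℂ) (n : ℕ), y = c • (A ^ n) x} := by
  intro hd
  have hb : ψ x ≠ 0 := apply_ne_zero_of_dense_projective_orbit (ψ := φ)
    (fun z w => (hsurj w z).imp fun _ h => h.symm) hψ hd
  have := forall_of_dense_projective_orbit hsurj hd (fun q => ‖ψ x‖ * ‖q.1‖ ≤ ‖φ x‖ * ‖q.2‖)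
    (isClosed_le (by fun_prop) (by fun_prop)) (fun c n => by
      simp only [apply_pow_of_dual_eigenvector hφ, apply_pow_of_dual_eigenvector hψ, norm_mul,
        norm_pow]
      calc ‖ψ x‖ * (‖c‖ * (‖l‖ ^ n * ‖φ x‖)) = ‖ψ x‖ * ‖c‖ * ‖φ x‖ * ‖l‖ ^ n := by ring
        _ ≤ ‖ψ x‖ * ‖c‖ * ‖φ x‖ * ‖m‖ ^ n := by gcongr
        _ = ‖φ x‖ * (‖c‖ * (‖m‖ ^ n * ‖ψ x‖)) := by ring) 1 0
  exact hb (by simpa using this)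

/-- If the transpose of `A` has a Jordan chain of length two, then `A` has no dense projective
orbit. -/
theorem not_dense_projective_orbit_of_dual_jordan_pair {φ ψ : Dual ℂ W} {l : ℂ}
    (hsurj : ∀ z w, ∃ v, φ v = z ∧ ψ v = w) (hφ : ∀ v, φ (A v) = l * φ v)
    (hψ : ∀ v, ψ (A v) = l * ψ v + φ v) :
    ¬ Dense {y : W | ∃ (c : ℂ) (n : ℕ), y = c • (A ^ n) x} := by
  intro hd
  have ha : φ x ≠ 0 := apply_ne_zero_of_dense_projective_orbit hsurj hφ hd
  by_cases hl : l = 0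
  · have key := forall_of_dense_projective_orbit hsurj hd
      (fun q => q.1 * (ψ x * q.1 - φ x * q.2) = 0)
      (isClosed_eq (by fun_prop) (by fun_prop)) (fun c n => by
        cases n with
        | zero => simp only [pow_zero, Module.End.one_apply]; ring
        | succ n => simp [apply_pow_of_dual_eigenvector hφ, hl])
    have h0 := key 1 0
    have h1 := key 1 1
    exact ha (by linear_combination h0 - h1)
  · have key := forall_of_dense_projective_orbit hsurj hd
      (fun q => 0 ≤ (l * (φ x * q.2 - ψ x * q.1) * (starRingEnd ℂ) (φ x * q.1)).re)
      (isClosed_le (by fun_prop) (by fun_prop)) (fun c n => by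
        have h : l * (φ x * (c * ψ ((A ^ n) x)) - ψ x * (c * φ ((A ^ n) x))) =
            ((n : ℝ) : ℂ) * (φ x * (c * φ ((A ^ n) x))) := by
          have := mul_apply_pow_of_dual_jordan_pair hφ hψ n x
          rw [apply_pow_of_dual_eigenvector hφ]
          push_cast
          linear_combination φ x * c * this
        simp only [h]
        rw [mul_assoc, Complex.mul_conj, ← Complex.ofReal_mul, Complex.ofReal_re]
        exact mul_nonneg n.cast_nonneg (Complex.normSq_nonneg _))
      1 ((ψ x - φ x / l) / φ x)
    have h : l * (φ x * ((ψ x - φ x / l) / φ x) - ψ x * 1) = -(φ x) := by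
      field_simp
      ring
    simp only [h] at key
    rw [mul_one, neg_mul, Complex.mul_conj, Complex.neg_re, Complex.ofReal_re] at key
    have := Complex.normSq_pos.2 ha
    linarith

end Orbits

/-- a linear map on a finite-dimensional complex normed space is never
hypercyclic unless the space is zero, and never supercyclic unless the dimension is at
most one. -/
theorem finite_dimensional_hypercyclic_supercyclic
    {W : Type*} [NormedAddCommGroup W] [NormedSpace ℂ W] [FiniteDimensional ℂ W]
    (A : W →ₗ[ℂ] W) :
    ((∃ x : W, Dense {y : W | ∃ n : ℕ, y = (A ^ n) x}) → ∀ w : W, w = 0) ∧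
    ((∃ x : W, Dense {y : W | ∃ (c : ℂ) (n : ℕ), y = c • (A ^ n) x}) →
      Module.finrank ℂ W ≤ 1) := by
  refine ⟨?_, ?_⟩
  · rintro ⟨x, hd⟩
    by_contra! h
    obtain ⟨w, hw⟩ := h
    have : Nontrivial W := ⟨w, 0, hw⟩
    obtain ⟨φ, l, hφ0, hφ⟩ := exists_dual_eigenvector A
    exact not_dense_orbit_of_dual_eigenvector hφ0 hφ hd
  · rintro ⟨x, hd⟩
    by_contra! h
    obtain ⟨φ, ψ, hsurj, l, hφ, ⟨m, hψ⟩ | hψ⟩ := exists_dual_eigenpair_or_jordan_pair h A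
    · rcases le_total ‖l‖ ‖m‖ with hlm | hlm
      · exact not_dense_projective_orbit_of_norm_le hsurj hφ hψ hlm hd
      · exact not_dense_projective_orbit_of_norm_le
          (fun z w => (hsurj w z).imp fun _ h => h.symm) hψ hφ hlm hd
    · exact not_dense_projective_orbit_of_dual_jordan_pair hsurj hφ hψ hd
end

section
/- Let V be a complex Banach space, S : V → V a compact continuous linear operator, and (W_n)_{n ≥ 0} a decreasing sequence of closed ℂ-linear subspaces of V (W_{n+1} ⊆ W_n) such that S(W_n) ⊆ W_n for every n and ⋂_{n ≥ 0} W_n = {0}. Then the norms of the restrictions tend to zero: for every ε > 0 there exists N such that for all n ≥ N and all x ∈ W_n, ‖S x‖ ≤ ε · ‖x‖. -/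
/-- if `S` is a compact operator on a complex Banach space and `(W n)` is a
decreasing sequence of closed `S`-invariant subspaces with trivial intersection, then the
norms of the restrictions `S|_{W n}` tend to zero. -/
theorem compact_operator_restriction_norm_tendsto_zero
    {V : Type*} [NormedAddCommGroup V] [NormedSpace ℂ V] [CompleteSpace V]
    (S : V →L[ℂ] V) (hS : IsCompactOperator (⇑S))
    (W : ℕ → Submodule ℂ V)
    (hclosed : ∀ n, IsClosed (W n : Set V))
    (hdec : ∀ n, W (n + 1) ≤ W n)
    (hinv : ∀ n, ∀ x ∈ W n, S x ∈ W n)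
    (hint : ∀ x : V, (∀ n, x ∈ W n) → x = 0) :
    ∀ ε : ℝ, 0 < ε → ∃ N : ℕ, ∀ n ≥ N, ∀ x ∈ W n, ‖S x‖ ≤ ε * ‖x‖ := by
  intro ε hε
  obtain ⟨K, hK, hSK⟩ := IsCompactOperator.image_closedBall_subset_compact (f := S.toLinearMap) hS 1
  have hanti : Antitone W := antitone_nat_of_succ_le hdec
  let C : ℕ → Set V := fun n => K ∩ ((W n : Set V) ∩ {y | ε ≤ ‖y‖})
  have hCclosed : ∀ n, IsClosed ((W n : Set V) ∩ {y | ε ≤ ‖y‖}) := fun n =>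
    (hclosed n).inter (isClosed_le continuous_const continuous_norm)
  obtain ⟨N, hN⟩ : ∃ N, ¬ (C N).Nonempty := by
    by_contra! hne
    obtain ⟨y, hy⟩ := IsCompact.nonempty_iInter_of_sequence_nonempty_isCompact_isClosed C
      (fun n y hy => ⟨hy.1, hdec n hy.2.1, hy.2.2⟩) hne
      (hK.inter_right (hCclosed 0)) (fun n => hK.isClosed.inter (hCclosed n))
    rw [Set.mem_iInter] at hy
    have hεy : ε ≤ ‖y‖ := (hy 0).2.2
    rw [hint y fun n => (hy n).2.1, norm_zero] at hεy
    exact hεy.not_gt hε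
  refine ⟨N, fun n hn x hx => ?_⟩
  rcases eq_or_ne x 0 with rfl | hx0
  · simp
  have hxpos : 0 < ‖x‖ := norm_pos_iff.mpr hx0
  set u : V := ((‖x‖⁻¹ : ℝ) : ℂ) • x with hu
  have huW : S u ∈ W N := hinv N u ((W N).smul_mem _ (hanti hn hx))
  have huK : S u ∈ K := by
    refine hSK ⟨u, ?_, rfl⟩
    rw [mem_closedBall_zero_iff, hu, norm_smul, Complex.norm_real, norm_inv, norm_norm,
      inv_mul_cancel₀ hxpos.ne']
  have hSu : ‖S u‖ < ε := by
    by_contra! h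
    exact hN ⟨S u, huK, huW, h⟩
  rw [hu, map_smul, norm_smul, Complex.norm_real, norm_inv, norm_norm, inv_mul_lt_iff₀ hxpos] at hSu
  linarith
end

section
/- Let U ⊆ ℂ be a nonempty connected open set and let V be a complex vector space with an injective linear map ι : V → (U → ℂ) such that ι(h) is holomorphic on U for every h ∈ V. If V is infinite-dimensional over ℂ, then for every p ∈ U and every N ≥ 0 there exist an integer n ≥ N and h ∈ V such that ι(h) vanishes to order exactly n at p, i.e. the k-th complex derivative of ι(h) at p is 0 for all k < n and the n-th complex derivative of ι(h) at p is nonzero. -/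
/-- if `V` is an infinite-dimensional space of functions holomorphic on a
nonempty connected open set `U ⊆ ℂ` (via an injective linear map `ι`), then for every
`p ∈ U` and every `N` there are `n ≥ N` and `h ∈ V` such that `ι h` vanishes to order
exactly `n` at `p`. -/
theorem infinite_dimensional_exact_vanishing_order
    {V : Type*} [AddCommGroup V] [Module ℂ V]
    (U : Set ℂ) (hUo : IsOpen U) (hUc : IsConnected U)
    (ι : V →ₗ[ℂ] (ℂ → ℂ))
    (hinj : ∀ h₁ h₂ : V, Set.EqOn (ι h₁) (ι h₂) U → h₁ = h₂)
    (hhol : ∀ h : V, DifferentiableOn ℂ (ι h) U)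
    (hV : ¬ Module.Finite ℂ V)
    (p : ℂ) (hp : p ∈ U) (N : ℕ) :
    ∃ n ≥ N, ∃ h : V,
      (∀ k < n, iteratedDerivWithin k (ι h) U p = 0) ∧
      iteratedDerivWithin n (ι h) U p ≠ 0 := by
  have han (h : V) : AnalyticOnNhd ℂ (ι h) U := (hhol h).analyticOnNhd hUo
  let T : V →ₗ[ℂ] (Fin N → ℂ) :=
    { toFun := fun h k ↦ iteratedDeriv k (ι h) p
      map_add' := fun f g ↦ by
        ext k
        simpa using iteratedDeriv_add (han f p hp).contDiffAt (han g p hp).contDiffAt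
      map_smul' := fun c f ↦ by
        ext k
        simp }
  have hT : ¬ Function.Injective T := fun h ↦ hV (Module.Finite.of_injective T h)
  rw [← LinearMap.ker_eq_bot, Submodule.eq_bot_iff] at hT
  push Not at hT
  obtain ⟨h, hTh, h0⟩ := hT
  have hle : (N : ℕ∞) ≤ analyticOrderAt (ι h) p :=
    (natCast_le_analyticOrderAt_iff_iteratedDeriv_eq_zero (han h p hp)).2
      fun i hi ↦ congrFun (LinearMap.mem_ker.1 hTh) ⟨i, hi⟩
  have htop : analyticOrderAt (ι h) p ≠ ⊤ := fun ht ↦ h0 <| hinj h 0 <| by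
    simpa using (han h).eqOn_zero_of_preconnected_of_eventuallyEq_zero hUc.isPreconnected hp
      (analyticOrderAt_eq_top.1 ht)
  obtain ⟨n, hn⟩ := ENat.ne_top_iff_exists.1 htop
  rw [← hn, Nat.cast_le] at hle
  refine ⟨n, hle, h, ?_⟩
  simpa only [iteratedDerivWithin_of_isOpen hUo hp] using
    (analyticOrderAt_eq_nat_iff_iteratedDeriv_eq_zero (han h p hp)).1 hn.symm
end

section
/- Let d ≥ 2 and let f : ℂ^d → ℂ^d be holomorphic (entire) and not affine. Then there exist a real number a with 0 < a < 1, a matrix U ∈ SU(d) (a d×d complex matrix with U*U = I and det U = 1), and a point p ∈ ℂ^d such that f(a · (U p)) = p and the Fréchet derivative at p of the map z ↦ f(a · (U z)) has an eigenvalue α with |α| > 1. -/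
open Filter Topology Set

/-- An entire curve of growth `O(|t| ^ (3 / 2))` is affine. -/
theorem eq_add_smul_deriv_of_norm_sq_le {E : Type*} [NormedAddCommGroup E] [NormedSpace ℂ E]
    [CompleteSpace E] {g : ℂ → E} (hg : Differentiable ℂ g) {C r : ℝ}
    (hC : ∀ t, r ≤ ‖t‖ → ‖g t‖ ^ 2 ≤ C * ‖t‖ ^ 3) (t : ℂ) :
    g t = g 0 + t • deriv g 0 := by
  have hderiv : Differentiable ℂ (deriv g) :=
    (hg.contDiff (n := 2)).differentiable_deriv_two
  have second_deriv_zero : ∀ w, deriv (deriv g) w = 0 := by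
    intro w
    have hbound : ∀ᶠ R : ℝ in atTop, ‖deriv (deriv g) w‖ ≤ 2 * Real.sqrt (8 * |C| / R) := by
      filter_upwards [eventually_ge_atTop (1 + ‖w‖ + |r|)] with R hR
      have hw := norm_nonneg w
      have hr := abs_nonneg r
      have hR0 : 0 < R := by linarith
      have hsphere : ∀ z ∈ Metric.sphere w R, ‖g z‖ ≤ Real.sqrt (8 * |C| * R ^ 3) := by
        intro z hz
        have hz' : ‖z - w‖ = R := by simpa [dist_eq_norm] using hz
        have hlow : R ≤ ‖z‖ + ‖w‖ := hz' ▸ norm_sub_le z w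
        have hup : ‖z‖ ≤ R + ‖w‖ := by
          have := norm_add_le (z - w) w
          rwa [sub_add_cancel, hz'] at this
        apply Real.le_sqrt_of_sq_le
        calc ‖g z‖ ^ 2 ≤ C * ‖z‖ ^ 3 := hC z (by linarith [le_abs_self r])
          _ ≤ |C| * ‖z‖ ^ 3 := by gcongr; exact le_abs_self C
          _ ≤ |C| * (2 * R) ^ 3 := by gcongr; linarith
          _ = 8 * |C| * R ^ 3 := by ring
      have h := Complex.norm_iteratedDeriv_le_of_forall_mem_sphere_norm_le 2 hR0
        hg.diffContOnCl hsphere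
      rw [iteratedDeriv_succ, iteratedDeriv_one] at h
      refine h.trans (le_of_eq ?_)
      have hs : 8 * |C| * R ^ 3 = (8 * |C| / R) * (R ^ 2) ^ 2 := by field_simp
      rw [hs, Real.sqrt_mul (by positivity), Real.sqrt_sq (by positivity)]
      have : R ^ 2 ≠ 0 := by positivity
      rw [Nat.factorial_two]
      push_cast
      field_simp
    have hlim : Tendsto (fun R : ℝ => 2 * Real.sqrt (8 * |C| / R)) atTop (𝓝 0) := by
      have h := (tendsto_const_nhds (x := 8 * |C|)).div_atTop tendsto_id
      simpa using (h.sqrt).const_mul 2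
    exact norm_le_zero_iff.mp (ge_of_tendsto hlim hbound)
  have hconst := is_const_of_deriv_eq_zero hderiv second_deriv_zero
  have hdiff : ∀ x, HasDerivAt (fun s : ℂ => g s - s • deriv g 0) 0 x := by
    intro x
    have h := (hg x).hasDerivAt.sub ((hasDerivAt_id x).smul_const (deriv g 0))
    rw [hconst x 0, one_smul, sub_self] at h
    exact h
  have h := is_const_of_deriv_eq_zero (fun x => (hdiff x).differentiableAt)
    (fun x => (hdiff x).deriv) t 0
  simp only [zero_smul, sub_zero] at h
  exact sub_eq_iff_eq_add.mp h

/-- A non-affine entire map satisfies no bound `‖f z‖ ^ 2 ≤ C * ‖z‖ ^ 3` outside the unit ball. -/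
theorem exists_norm_sq_gt_of_not_affine {E F : Type*} [NormedAddCommGroup E] [NormedSpace ℂ E]
    [NormedAddCommGroup F] [NormedSpace ℂ F] [CompleteSpace F]
    {f : E → F} (hf : Differentiable ℂ f)
    (hna : ¬ ∃ (A : E →ₗ[ℂ] F) (b : F), ∀ z, f z = A z + b) (C : ℝ) :
    ∃ z, 1 ≤ ‖z‖ ∧ C * ‖z‖ ^ 3 < ‖f z‖ ^ 2 := by
  by_contra! h
  refine hna ⟨(fderiv ℂ f 0).toLinearMap, f 0, fun z => ?_⟩
  rcases eq_or_ne z 0 with rfl | hz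
  · simp
  have hz' : 0 < ‖z‖ := norm_pos_iff.mpr hz
  have hline : ∀ t : ℂ, HasDerivAt (fun t : ℂ => t • z) z t := fun t => by
    simpa using (hasDerivAt_id t).smul_const z
  have hg : ∀ t : ℂ, HasDerivAt (fun t : ℂ => f (t • z)) (fderiv ℂ f (t • z) z) t := fun t =>
    (hf (t • z)).hasFDerivAt.comp_hasDerivAt t (hline t)
  have key := eq_add_smul_deriv_of_norm_sq_le (g := fun t : ℂ => f (t • z))
    (fun t => (hg t).differentiableAt) (C := C * ‖z‖ ^ 3) (r := 1 / ‖z‖) (fun t ht => by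
      have := h (t • z) (by rw [norm_smul]; exact (div_le_iff₀ hz').mp ht)
      rw [norm_smul] at this
      linarith [mul_pow ‖t‖ ‖z‖ 3, this, mul_assoc C (‖z‖ ^ 3) (‖t‖ ^ 3),
        mul_comm (‖z‖ ^ 3) (‖t‖ ^ 3), congrArg (C * ·) (mul_pow ‖t‖ ‖z‖ 3)]) 1
  rw [(hg 0).deriv] at key
  simpa [add_comm] using key

section InnerProduct

variable {E F : Type*} [NormedAddCommGroup E] [InnerProductSpace ℂ E]
  [NormedAddCommGroup F] [InnerProductSpace ℂ F]

/-- Derivative of the squared norm of a holomorphic map along a real curve. -/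
theorem hasDerivAt_norm_sq_comp {f : E → F} {γ : ℝ → E} {γ' : E} {t : ℝ}
    (hf : DifferentiableAt ℂ f (γ t)) (hγ : HasDerivAt γ γ' t) :
    HasDerivAt (fun s => ‖f (γ s)‖ ^ 2)
      (2 * (inner ℂ (f (γ t)) (fderiv ℂ f (γ t) γ')).re) t := by
  let _ := InnerProductSpace.rclikeToReal ℂ F
  have h1 : HasDerivAt (f ∘ γ) (fderiv ℂ f (γ t) γ') t :=
    (hf.hasFDerivAt.restrictScalars ℝ).comp_hasDerivAt t hγ
  exact h1.norm_sq

/-- Where `‖f‖` is maximal on a sphere centred at the origin, complex tangent vectors are mapped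
by the differential into the orthogonal complement of the value of `f`. -/
theorem inner_fderiv_eq_zero_of_max_on_sphere {f : E → F} {q : E}
    (hf : DifferentiableAt ℂ f q) (hq0 : q ≠ 0)
    (hmax : ∀ z, ‖z‖ = ‖q‖ → ‖f z‖ ≤ ‖f q‖) {v : E} (hv : inner ℂ q v = 0) : inner ℂ (f q) (fderiv ℂ f q v) = 0 := by
  have re_zero : ∀ w : E, ‖w‖ = ‖q‖ → inner ℂ q w = 0 →
      (inner ℂ (f q) (fderiv ℂ f q w)).re = 0 := by
    intro w hw hqw
    let γ : ℝ → E := fun t => ((Real.cos t : ℝ) : ℂ) • q + ((Real.sin t : ℝ) : ℂ) • w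
    have hγ0 : γ 0 = q := by simp [γ]
    have hγ : HasDerivAt γ w 0 := by
      have h := ((Real.hasDerivAt_cos 0).ofReal_comp.smul_const q).add
        ((Real.hasDerivAt_sin 0).ofReal_comp.smul_const w)
      simp only [Real.sin_zero, Real.cos_zero, neg_zero, Complex.ofReal_zero, Complex.ofReal_one,
        zero_smul, one_smul, zero_add] at h
      exact h
    have hnorm : ∀ t, ‖γ t‖ = ‖q‖ := by
      intro t
      have h := norm_add_sq_eq_norm_sq_add_norm_sq_of_inner_eq_zero
        (((Real.cos t : ℝ) : ℂ) • q) (((Real.sin t : ℝ) : ℂ) • w)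
        (by rw [inner_smul_left, inner_smul_right, hqw]; simp)
      simp only [norm_smul, Complex.norm_real, Real.norm_eq_abs, hw] at h
      refine (sq_eq_sq₀ (norm_nonneg _) (norm_nonneg _)).mp ?_
      rw [pow_two, h]
      linear_combination ‖q‖ ^ 2 * Real.sin_sq_add_cos_sq t +
        ‖q‖ ^ 2 * abs_mul_abs_self (Real.cos t) + ‖q‖ ^ 2 * abs_mul_abs_self (Real.sin t)
    have hd := hasDerivAt_norm_sq_comp (f := f) (γ := γ) (hγ0.symm ▸ hf) hγ
    have hloc : IsLocalMax (fun s => ‖f (γ s)‖ ^ 2) 0 := Eventually.of_forall fun s => by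
      simp only [hγ0]
      have := hmax (γ s) (hnorm s)
      gcongr
    have h := hloc.hasDerivAt_eq_zero hd
    rw [hγ0] at h
    linarith
  have full_zero : ∀ w : E, ‖w‖ = ‖q‖ → inner ℂ q w = 0 →
      inner ℂ (f q) (fderiv ℂ f q w) = 0 := by
    intro w hw hqw
    have h1 := re_zero w hw hqw
    have h2 := re_zero (Complex.I • w) (by simp [norm_smul, hw])
      (by rw [inner_smul_right, hqw, mul_zero])
    rw [map_smul, inner_smul_right, Complex.I_mul_re] at h2
    exact Complex.ext h1 (by simpa using h2)
  rcases eq_or_ne v 0 with rfl | hv0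
  · simp
  have hv1 : ‖v‖ ≠ 0 := norm_ne_zero_iff.mpr hv0
  have hq1 : ‖q‖ ≠ 0 := norm_ne_zero_iff.mpr hq0
  have h := full_zero (((‖q‖ / ‖v‖ : ℝ) : ℂ) • v)
    (by rw [norm_smul, Complex.norm_real, norm_div, norm_norm, norm_norm]; field_simp)
    (by rw [inner_smul_right, hv, mul_zero])
  rw [map_smul, inner_smul_right] at h
  exact (mul_eq_zero.mp h).resolve_left
    (Complex.ofReal_ne_zero.mpr (div_ne_zero hq1 hv1))

/-- If the norm grows along the ray through `q` at least like the power `3 / 2` up to `q`, the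
logarithmic radial derivative at `q` is at least `3 / 2`. -/
theorem le_re_inner_fderiv_of_radial_bound {f : E → F} {q : E}
    (hf : DifferentiableAt ℂ f q)
    (hmax : ∀ᶠ t : ℝ in 𝓝[<] 1, ‖f ((t : ℂ) • q)‖ ^ 2 ≤ ‖f q‖ ^ 2 * t ^ 3) :
    3 * ‖f q‖ ^ 2 ≤ 2 * (inner ℂ (f q) (fderiv ℂ f q q)).re := by
  have hγ : HasDerivAt (fun t : ℝ => (t : ℂ) • q) q 1 := by
    simpa using (hasDerivAt_id (1 : ℝ)).ofReal_comp.smul_const q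
  have hd := hasDerivAt_norm_sq_comp (f := f) (γ := fun t : ℝ => (t : ℂ) • q) (t := 1)
    (by simpa using hf) hγ
  have hh := hd.sub (((hasDerivAt_id (1 : ℝ)).pow 3).const_mul (‖f q‖ ^ 2))
  have hslope := hh.hasDerivWithinAt (s := Iio 1)
  rw [hasDerivWithinAt_iff_tendsto_slope' (by simp)] at hslope
  have hnonneg := ge_of_tendsto (b := (0 : ℝ)) hslope (by
    filter_upwards [hmax, self_mem_nhdsWithin] with t ht ht1
    rw [slope_def_field]
    apply div_nonneg_of_nonpos
    · simpa using ht
    · exact sub_nonpos.mpr (le_of_lt ht1))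
  simp at hnonneg
  linarith

/-- A non-affine entire map has a point `q` with `‖q‖ < ‖f q‖` that maximizes `‖f‖` on its sphere
and at which the logarithmic radial derivative is at least `3 / 2`. -/
theorem exists_expanding_max_point [FiniteDimensional ℂ E] [CompleteSpace F]
    {f : E → F} (hf : Differentiable ℂ f)
    (hna : ¬ ∃ (A : E →ₗ[ℂ] F) (b : F), ∀ z, f z = A z + b) :
    ∃ q : E, q ≠ 0 ∧ ‖q‖ < ‖f q‖ ∧ (∀ z, ‖z‖ = ‖q‖ → ‖f z‖ ≤ ‖f q‖) ∧
      3 * ‖f q‖ ^ 2 ≤ 2 * (inner ℂ (f q) (fderiv ℂ f q q)).re := by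
  have : ProperSpace E := FiniteDimensional.proper ℂ E
  obtain ⟨C, hC⟩ := (isCompact_sphere (0 : E) 1).exists_bound_of_continuousOn
    hf.continuous.continuousOn
  obtain ⟨z₀, hz₀, hlarge⟩ := exists_norm_sq_gt_of_not_affine hf hna (1 + C ^ 2)
  let S : Set E := Metric.closedBall 0 ‖z₀‖ ∩ {z | 1 ≤ ‖z‖}
  have hS : IsCompact S :=
    (isCompact_closedBall _ _).inter_right (isClosed_le continuous_const continuous_norm)
  have hz₀S : z₀ ∈ S := ⟨by simp, hz₀⟩
  have hcont : ContinuousOn (fun z => ‖f z‖ ^ 2 / ‖z‖ ^ 3) S := by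
    apply ContinuousOn.div (hf.continuous.norm.pow 2).continuousOn
      (continuous_norm.pow 3).continuousOn
    intro z hz
    have : (1 : ℝ) ≤ ‖z‖ := hz.2
    exact (pow_pos (by linarith) 3).ne'
  obtain ⟨q, ⟨hqball, hq1⟩, hmax⟩ := hS.exists_isMaxOn ⟨z₀, hz₀S⟩ hcont
  have hq1 : 1 ≤ ‖q‖ := hq1
  have hqle : ‖q‖ ≤ ‖z₀‖ := by simpa using hqball
  have hq0 : 0 < ‖q‖ := by linarith
  have hvalue : (1 + C ^ 2) * ‖q‖ ^ 3 < ‖f q‖ ^ 2 := by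
    rw [← lt_div_iff₀ (by positivity)]
    refine lt_of_lt_of_le ?_ (hmax hz₀S)
    have : 0 < ‖z₀‖ := by linarith
    rwa [lt_div_iff₀ (by positivity)]
  have hq_gt : 1 < ‖q‖ := by
    refine lt_of_le_of_ne hq1 fun h => ?_
    have hCq := hC q (by simpa using h.symm)
    rw [← h] at hvalue
    nlinarith [norm_nonneg (f q)]
  have hbound : ∀ z, 1 ≤ ‖z‖ → ‖z‖ ≤ ‖q‖ → ‖f z‖ ^ 2 ≤ ‖f q‖ ^ 2 / ‖q‖ ^ 3 * ‖z‖ ^ 3 := by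
    intro z hz1 hzq
    have hz : 0 < ‖z‖ := by linarith
    rw [← div_le_iff₀ (by positivity)]
    exact hmax ⟨by simpa using hzq.trans hqle, hz1⟩
  refine ⟨q, norm_pos_iff.mp hq0, ?_, ?_, ?_⟩
  · refine lt_of_pow_lt_pow_left₀ 2 (norm_nonneg _) (lt_of_le_of_lt ?_ hvalue)
    calc ‖q‖ ^ 2 ≤ ‖q‖ ^ 3 := pow_le_pow_right₀ hq1 (by norm_num)
      _ ≤ (1 + C ^ 2) * ‖q‖ ^ 3 := le_mul_of_one_le_left (by positivity) (by nlinarith)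
  · intro z hz
    have h := hbound z (hz ▸ hq1) hz.le
    rw [hz, div_mul_cancel₀ _ (by positivity)] at h
    exact (pow_le_pow_iff_left₀ (norm_nonneg _) (norm_nonneg _) (by norm_num)).mp h
  · apply le_re_inner_fderiv_of_radial_bound (hf q)
    have hinv : ‖q‖⁻¹ < 1 := inv_lt_one_of_one_lt₀ hq_gt
    filter_upwards [Ioo_mem_nhdsLT hinv] with t ht
    have ht0 : 0 < t := lt_trans (by positivity) ht.1
    have hnorm : ‖(t : ℂ) • q‖ = t * ‖q‖ := by
      rw [norm_smul, Complex.norm_real, Real.norm_of_nonneg ht0.le]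
    have h := hbound ((t : ℂ) • q)
      (by rw [hnorm]; exact ((inv_lt_iff_one_lt_mul₀ hq0).mp ht.1).le.trans_eq (by ring))
      (by rw [hnorm]; exact mul_le_of_le_one_left hq0.le ht.2.le)
    rw [hnorm] at h
    refine h.trans_eq ?_
    field_simp

/-- Let `A` scale inner products by `‖q‖ ^ 2 / ‖p‖ ^ 2` and map `p` to `q`. If `D` sends the
orthogonal complement of `q` to that of `p`, then `D ∘ A` has the eigenvalue
`⟪p, D q⟫ / ‖p‖ ^ 2`. -/
theorem exists_eigenvector_of_map_orthogonal [FiniteDimensional ℂ E] (D A : E →ₗ[ℂ] E) {p q : E}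
    (hp : p ≠ 0) (hq : q ≠ 0) (hA : A p = q) {c : ℂ}
    (hinner : ∀ v, inner ℂ q (A v) = c * inner ℂ p v)
    (hD : ∀ v, inner ℂ q v = 0 → inner ℂ p (D v) = 0) :
    ∃ v, v ≠ 0 ∧ D (A v) = (inner ℂ p (D q) / inner ℂ p p) • v := by
  have hpp : inner ℂ p p ≠ 0 := inner_self_ne_zero.mpr hp
  have hqq : inner ℂ q q ≠ 0 := inner_self_ne_zero.mpr hq
  set α := inner ℂ p (D q) / inner ℂ p p with hα
  have hc : inner ℂ q q = c * inner ℂ p p := by rw [← hinner, hA]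
  have hleft : ∀ v, inner ℂ p (D (A v)) = α * inner ℂ p v := by
    intro v
    have h := hD (A v - (inner ℂ q (A v) / inner ℂ q q) • q) (by
      rw [inner_sub_right, inner_smul_right, div_mul_cancel₀ _ hqq, sub_self])
    rw [map_sub, map_smul, inner_sub_right, inner_smul_right, sub_eq_zero] at h
    have hc0 : c ≠ 0 := fun h0 => hqq (by rw [hc, h0, zero_mul])
    rw [h, hinner, hc, hα]
    field_simp
  let L : E →ₗ[ℂ] E := D ∘ₗ A - α • LinearMap.id
  have hL : ∀ v, L v = D (A v) - α • v := fun v => rfl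
  have hnotsurj : ¬ Function.Surjective L := by
    intro hs
    obtain ⟨v, hv⟩ := hs p
    apply hpp
    nth_rewrite 2 [← hv]
    rw [hL, inner_sub_right, inner_smul_right, hleft, sub_self]
  rw [← LinearMap.injective_iff_surjective, injective_iff_map_eq_zero] at hnotsurj
  push Not at hnotsurj
  obtain ⟨v, hv, hv0⟩ := hnotsurj
  exact ⟨v, hv0, sub_eq_zero.mp (hL v ▸ hv)⟩

end InnerProduct

/-- In dimension at least two, `SU(d)` acts transitively on the unit sphere. -/
theorem exists_specialUnitary_mulVec_eq {d : ℕ} (hd : 2 ≤ d) {x y : EuclideanSpace ℂ (Fin d)}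
    (hx : ‖x‖ = 1) (hy : ‖y‖ = 1) :
    ∃ U : Matrix (Fin d) (Fin d) ℂ, U.conjTranspose * U = 1 ∧ U.det = 1 ∧
      U.mulVec x.ofLp = y.ofLp := by
  let i₀ : Fin d := ⟨0, by omega⟩
  let i₁ : Fin d := ⟨1, by omega⟩
  have hi : i₀ ≠ i₁ := by simp [i₀, i₁]
  have frame : ∀ z : EuclideanSpace ℂ (Fin d), ‖z‖ = 1 →
      ∃ P ∈ Matrix.unitaryGroup (Fin d) ℂ, P.mulVec (Pi.single i₀ 1) = z.ofLp := by
    intro z hz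
    obtain ⟨b, hb⟩ := Orthonormal.exists_orthonormalBasis_extension_of_card_eq
      (𝕜 := ℂ) (E := EuclideanSpace ℂ (Fin d)) (ι := Fin d) (by simp) (v := fun _ => z)
      (s := {i₀}) ⟨fun i => hz, fun i j hij => (hij (Subsingleton.elim i j)).elim⟩
    refine ⟨_, (EuclideanSpace.basisFun (Fin d) ℂ).toMatrix_orthonormalBasis_mem_unitary b, ?_⟩
    ext i
    simp [Module.Basis.toMatrix_apply, hb i₀ rfl]
  obtain ⟨P, hP, hPx⟩ := frame x hx
  obtain ⟨Q, hQ, hQy⟩ := frame y hy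
  have hPdet := Matrix.det_of_mem_unitary hP
  have hQdet := Matrix.det_of_mem_unitary hQ
  have hPs : star P ∈ Matrix.unitaryGroup (Fin d) ℂ := Unitary.star_mem hP
  let c : ℂ := star Q.det * P.det
  have hc : star c * c = 1 := by
    have h1 := Unitary.mul_star_self_of_mem hQdet
    have h2 := Unitary.star_mul_self_of_mem hPdet
    simp only [c, star_mul, star_star]
    linear_combination (star P.det * P.det) * h1 + h2
  let Δ : Matrix (Fin d) (Fin d) ℂ := Matrix.diagonal (Function.update 1 i₁ c)
  have hΔ : Δ ∈ Matrix.unitaryGroup (Fin d) ℂ := by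
    rw [Matrix.mem_unitaryGroup_iff']
    simp only [Δ, Matrix.star_eq_conjTranspose, Matrix.diagonal_conjTranspose,
      Matrix.diagonal_mul_diagonal]
    rw [← Matrix.diagonal_one]
    congr 1
    ext i
    rcases eq_or_ne i i₁ with rfl | h
    · simpa using hc
    · simp [h]
  have hΔdet : Δ.det = c := by
    simp [Δ, Matrix.det_diagonal, Finset.prod_update_of_mem]
  refine ⟨Q * Δ * star P, ?_, ?_, ?_⟩
  · exact Matrix.mem_unitaryGroup_iff'.mp (mul_mem (mul_mem hQ hΔ) hPs)
  · have h1 := Unitary.mul_star_self_of_mem hQdet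
    have h2 := Unitary.star_mul_self_of_mem hPdet
    rw [Matrix.det_mul, Matrix.det_mul, hΔdet, Matrix.star_eq_conjTranspose,
      Matrix.det_conjTranspose]
    simp only [c]
    linear_combination (star P.det * P.det) * h1 + h2
  · have hsingle : Δ.mulVec (Pi.single i₀ 1) = Pi.single i₀ 1 := by
      ext i
      simp only [Δ, Matrix.mulVec_single_one, Matrix.col_apply, Matrix.diagonal_apply]
      rcases eq_or_ne i i₀ with rfl | h
      · simp [hi]
      · simp [h]
    rw [← hPx, Matrix.mulVec_mulVec, Matrix.mul_assoc, Unitary.star_mul_self_of_mem hP,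
      Matrix.mul_one, ← Matrix.mulVec_mulVec, hsingle, hQy]

/-- for `d ≥ 2` and a non-affine entire map `f : ℂ^d → ℂ^d`, there exist
`a ∈ (0, 1)`, `U ∈ SU(d)`, and a point `p` such that `p` is a fixed point of
`z ↦ f(a • (U z))` whose derivative there has an eigenvalue of modulus greater than 1. -/
theorem nonaffine_entire_map_repelling_fixed_point
    {d : ℕ} (hd : 2 ≤ d)
    (f : (Fin d → ℂ) → (Fin d → ℂ)) (hf : Differentiable ℂ f)
    (hna : ¬ ∃ (A : (Fin d → ℂ) →ₗ[ℂ] (Fin d → ℂ)) (b : Fin d → ℂ),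
      ∀ z, f z = A z + b) :
    ∃ (a : ℝ) (U : Matrix (Fin d) (Fin d) ℂ) (p : Fin d → ℂ),
      0 < a ∧ a < 1 ∧ U.conjTranspose * U = 1 ∧ U.det = 1 ∧
      f ((a : ℂ) • U.mulVec p) = p ∧
      ∃ α : ℂ, 1 < ‖α‖ ∧ ∃ v : Fin d → ℂ, v ≠ 0 ∧
        fderiv ℂ (fun z => f ((a : ℂ) • U.mulVec z)) p v = α • v := by
  let e : EuclideanSpace ℂ (Fin d) ≃L[ℂ] (Fin d → ℂ) := EuclideanSpace.equiv (Fin d) ℂ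
  let F : EuclideanSpace ℂ (Fin d) → EuclideanSpace ℂ (Fin d) := fun z => e.symm (f (e z))
  have hFderiv : ∀ z, HasFDerivAt F
      ((e.symm : (Fin d → ℂ) →L[ℂ] EuclideanSpace ℂ (Fin d)) ∘L fderiv ℂ f (e z) ∘L
        (e : EuclideanSpace ℂ (Fin d) →L[ℂ] (Fin d → ℂ))) z := fun z =>
    e.symm.hasFDerivAt.comp z ((hf (e z)).hasFDerivAt.comp z e.hasFDerivAt)
  have hFna : ¬ ∃ (A : EuclideanSpace ℂ (Fin d) →ₗ[ℂ] EuclideanSpace ℂ (Fin d))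
      (b : EuclideanSpace ℂ (Fin d)), ∀ z, F z = A z + b := by
    rintro ⟨A, b, h⟩
    refine hna ⟨e.toLinearEquiv.toLinearMap ∘ₗ A ∘ₗ e.symm.toLinearEquiv.toLinearMap, e b,
      fun z => ?_⟩
    have := congrArg e (h (e.symm z))
    simpa [F] using this
  obtain ⟨q, hq0, hlt, hmax, hrad⟩ :=
    exists_expanding_max_point (fun z => (hFderiv z).differentiableAt) hFna
  have hqpos : 0 < ‖q‖ := norm_pos_iff.mpr hq0
  set p := F q with hp
  have hppos : 0 < ‖p‖ := hqpos.trans hlt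
  have hp0 : p ≠ 0 := norm_pos_iff.mp hppos
  have hnormalize : ∀ z : EuclideanSpace ℂ (Fin d), z ≠ 0 → ‖((‖z‖⁻¹ : ℝ) : ℂ) • z‖ = 1 :=
    fun z hz => by
      rw [norm_smul, Complex.norm_real, norm_inv, norm_norm,
        inv_mul_cancel₀ (norm_ne_zero_iff.mpr hz)]
  obtain ⟨U, hU, hUdet, hUpq⟩ :=
    exists_specialUnitary_mulVec_eq hd (hnormalize p hp0) (hnormalize q hq0)
  let a : ℝ := ‖q‖ / ‖p‖
  let A : EuclideanSpace ℂ (Fin d) →ₗ[ℂ] EuclideanSpace ℂ (Fin d) :=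
    (a : ℂ) • Matrix.toEuclideanLin U
  have hAe : ∀ z, e (A z) = (a : ℂ) • U.mulVec (e z) := fun z => rfl
  have hAp : A p = q := by
    have hUp : U.mulVec p.ofLp = ((‖p‖ * ‖q‖⁻¹ : ℝ) : ℂ) • q.ofLp := by
      have h := congrArg (((‖p‖ : ℝ) : ℂ) • ·) hUpq
      simp only [WithLp.ofLp_smul, Matrix.mulVec_smul, smul_smul] at h
      rw [← Complex.ofReal_mul, mul_inv_cancel₀ hppos.ne', Complex.ofReal_one, one_smul] at h
      rw [h, Complex.ofReal_mul]
    apply e.injective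
    rw [hAe]
    change (a : ℂ) • U.mulVec p.ofLp = q.ofLp
    rw [hUp, smul_smul, ← Complex.ofReal_mul]
    have : a * (‖p‖ * ‖q‖⁻¹) = 1 := by
      simp only [a]
      field_simp
    rw [this, Complex.ofReal_one, one_smul]
  have hinner : ∀ v, inner ℂ q (A v) = ((a * a : ℝ) : ℂ) * inner ℂ p v := by
    intro v
    have hUinner : inner ℂ (Matrix.toEuclideanLin U p) (Matrix.toEuclideanLin U v) =
        inner ℂ p v := by
      rw [← LinearMap.adjoint_inner_right, ← Matrix.toEuclideanLin_conjTranspose_eq_adjoint,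
        ← LinearMap.comp_apply, ← Matrix.toLpLin_mul_same, hU, Matrix.toLpLin_one]
      rfl
    rw [← hAp]
    simp only [A, LinearMap.smul_apply]
    rw [inner_smul_left, inner_smul_right, hUinner, Complex.conj_ofReal]
    push_cast
    ring
  obtain ⟨v, hv0, hv⟩ := exists_eigenvector_of_map_orthogonal
    (fderiv ℂ F q).toLinearMap A hp0 hq0 hAp hinner fun v hv =>
      inner_fderiv_eq_zero_of_max_on_sphere (hFderiv q).differentiableAt hq0 hmax hv
  have heq : (a : ℂ) • U.mulVec (e p) = e q := by rw [← hAe, hAp]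
  refine ⟨a, U, e p, div_pos hqpos hppos, (div_lt_one hppos).mpr hlt, hU, hUdet, ?_,
    inner ℂ p (fderiv ℂ F q q) / inner ℂ p p, ?_, e v, by simpa using hv0, ?_⟩
  · rw [heq, hp]
    simp [F]
  · have hnorm : ‖inner ℂ p p‖ = ‖p‖ ^ 2 := by
      rw [inner_self_eq_norm_sq_to_K]
      simp
    rw [norm_div, hnorm, one_lt_div (by positivity)]
    have h := Complex.re_le_norm (inner ℂ p (fderiv ℂ F q q))
    linarith [pow_pos hppos 2]
  · have hlin : HasFDerivAt (fun z : Fin d → ℂ => (a : ℂ) • U.mulVec z)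
        ((a : ℂ) • U.mulVecLin.toContinuousLinearMap) (e p) :=
      ((a : ℂ) • U.mulVecLin.toContinuousLinearMap).hasFDerivAt
    have hcomp := (hf ((a : ℂ) • U.mulVec (e p))).hasFDerivAt.comp (e p) hlin
    have h := congrArg e hv
    rw [ContinuousLinearMap.coe_coe, (hFderiv q).fderiv] at h
    rw [(hFderiv q).fderiv]
    change fderiv ℂ (f ∘ fun z => (a : ℂ) • U.mulVec z) (e p) (e v) = _
    rw [hcomp.fderiv, heq]
    rw [map_smul e] at h
    refine Eq.trans ?_ h
    change fderiv ℂ f (e q) ((a : ℂ) • U.mulVec (e v)) =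
      e (e.symm (fderiv ℂ f (e q) (e (A v))))
    rw [e.apply_symm_apply, hAe]
end

section
/- Let f be a polynomial over ℂ of degree d ≥ 2 and suppose f has exactly one fixed point, i.e. there is p ∈ ℂ with {z ∈ ℂ : f(z) = z} = {p}. Then f has a point of exact period 2: there exists q ∈ ℂ with f(f(q)) = q and f(q) ≠ q. In particular, the set {z ∈ ℂ : f(f(z)) = z} contains at least the three distinct points p, q, and f(q). -/
/-- Over an algebraically closed field, a polynomial all of whose roots equal `p` is a constant
multiple of a power of `X - p`. -/
theorem Polynomial.eq_C_mul_X_sub_C_pow_of_forall_isRoot {K : Type*} [Field K] [IsAlgClosed K]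
    (g : Polynomial K) (p : K) (h : ∀ z ∈ g.roots, z = p) :
    g = Polynomial.C g.leadingCoeff * (Polynomial.X - Polynomial.C p) ^ g.natDegree := by
  have hs := IsAlgClosed.splits g
  have hr : g.roots = Multiset.replicate g.natDegree p :=
    Multiset.eq_replicate.2 ⟨hs.natDegree_eq_card_roots.symm, h⟩
  have he := hs.eq_prod_roots
  rw [hr] at he
  simpa using he

/-- a complex polynomial of degree at least 2 with a unique fixed point
`p` has a point `q` of exact period 2; in particular `p`, `q`, `f(q)` are three distinct
points fixed by the second iterate. -/
theorem polynomial_unique_fixed_point_has_period_two_point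
    (f : Polynomial ℂ) (hdeg : 2 ≤ f.natDegree)
    (p : ℂ) (hfix : {z : ℂ | f.eval z = z} = {p}) :
    ∃ q : ℂ, f.eval (f.eval q) = q ∧ f.eval q ≠ q ∧
      q ≠ p ∧ f.eval q ≠ p ∧ f.eval (f.eval p) = p := by
  have hiff : ∀ z, f.eval z = z ↔ z = p := fun z => by
    simpa using Set.ext_iff.1 hfix z
  have hp : f.eval p = p := (hiff p).2 rfl
  have hnd : (f - Polynomial.X).natDegree = f.natDegree :=
    Polynomial.natDegree_sub_eq_left_of_natDegree_lt (by rw [Polynomial.natDegree_X]; omega)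
  have hc : (f - Polynomial.X).leadingCoeff ≠ 0 := by
    rw [Polynomial.leadingCoeff_ne_zero]
    rintro h
    rw [h, Polynomial.natDegree_zero] at hnd
    omega
  have hg := Polynomial.eq_C_mul_X_sub_C_pow_of_forall_isRoot (f - Polynomial.X) p fun z hz => by
    have hz' := Polynomial.isRoot_of_mem_roots hz
    rw [Polynomial.IsRoot, Polynomial.eval_sub, Polynomial.eval_X, sub_eq_zero] at hz'
    exact (hiff z).1 hz'
  rw [hnd] at hg
  generalize (f - Polynomial.X).leadingCoeff = c at hg hc
  obtain ⟨n, hn⟩ : ∃ n, f.natDegree = n + 2 := ⟨f.natDegree - 2, by omega⟩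
  rw [hn] at hg
  have hev : ∀ z, f.eval z = z + c * (z - p) ^ (n + 2) := fun z => by
    have := congrArg (Polynomial.eval z) hg
    simp only [Polynomial.eval_sub, Polynomial.eval_X, Polynomial.eval_mul, Polynomial.eval_C,
      Polynomial.eval_pow] at this
    linear_combination this
  obtain ⟨w, hw⟩ := IsAlgClosed.exists_pow_nat_eq (-1 : ℂ) (n := n + 2) (by omega)
  obtain ⟨u, hu⟩ := IsAlgClosed.exists_pow_nat_eq ((w - 1) / c) (n := n + 1) (by omega)
  have hcu : c * u ^ (n + 1) = w - 1 := by rw [hu]; field_simp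
  have hu0 : u ≠ 0 := by
    rintro rfl
    have hw1 : w = 1 := by
      rw [zero_pow (by omega), mul_zero] at hcu
      linear_combination -hcu
    rw [hw1, one_pow] at hw
    norm_num at hw
  have hqp : p + u ≠ p := by simpa using hu0
  have hq : f.eval (p + u) = p + u * w := by
    rw [hev, add_sub_cancel_left]
    linear_combination u * hcu
  have hqq : f.eval (f.eval (p + u)) = p + u := by
    rw [hq, hev, add_sub_cancel_left, mul_pow, hw]
    linear_combination -u * hcu
  refine ⟨p + u, hqq, fun h => hqp ((hiff _).1 h), hqp, fun h => hqp ?_, by rw [hp, hp]⟩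
  rw [← hqq, h, hp]
end
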